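/- arXiv:1709.03475 — 2 statements merged into one kernel-verified Lean document; each statement's English description precedes it below -/
import Mathlib

section
/- Let 0 < T < S < 1. Suppose there exists r₀ > 0 such that for every r > r₀, (1/π)·∫_0^∞ w_r(t)·(A_t(S,T) − π/(√(1−T)·√(1−S))) dt = 0, where the integral is over real t. Then A_t(S,T) = π/(√(1−T)·√(1−S)) for every real t. -/
open MeasureTheory

/-- The closed form of the product of the two hypergeometric factors:
`K_t(z) = cos(4·i·t·arcsin(√Y(z))) · cos(2·t·log(√(x(z)+1)+√x(z)))`, where
`Y(z) = (1+√z)(√z−√T)/(2(1−√T)√z)` and `x(z) = (S−z)(1−z)/((1−√S)²z)`. -/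
noncomputable def Kker (S T : ℝ) (t : ℂ) (z : ℝ) : ℂ :=
  Complex.cos (4 * Complex.I * t *
      (Real.arcsin (Real.sqrt ((1 + Real.sqrt z) * (Real.sqrt z - Real.sqrt T) /
        (2 * (1 - Real.sqrt T) * Real.sqrt z))) : ℝ)) *
  Complex.cos (2 * t *
      (Real.log (Real.sqrt ((S - z) * (1 - z) / ((1 - Real.sqrt S) ^ 2 * z) + 1) +
        Real.sqrt ((S - z) * (1 - z) / ((1 - Real.sqrt S) ^ 2 * z))) : ℝ))

/-- `A_t(S,T) = ∫_T^S K_t(z)/((1−z)√(z−T)√(S−z)) dz`. -/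
noncomputable def Aint (S T : ℝ) (t : ℂ) : ℂ :=
  ∫ z in T..S, Kker S T t z /
    (((1 - z : ℝ) : ℂ) * (Real.sqrt (z - T) : ℝ) * (Real.sqrt (S - z) : ℝ))

/-- The weight `w_r(t) = Γ(2it)Γ(−2it)(Γ(1/2+2it)Γ(1/2−2it))²/(Γ(4it)Γ(−4it)) ·
(1+r)^{−1/2}·cos(4t·log(√(r+1)+√r))`. -/
noncomputable def wfun (r t : ℝ) : ℂ :=
  Complex.Gamma (2 * Complex.I * t) * Complex.Gamma (-(2 * Complex.I * t)) *
    (Complex.Gamma (1 / 2 + 2 * Complex.I * t) * Complex.Gamma (1 / 2 - 2 * Complex.I * t)) ^ 2 /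
    (Complex.Gamma (4 * Complex.I * t) * Complex.Gamma (-(4 * Complex.I * t))) *
    (((1 + r) ^ (-(1 / 2 : ℝ)) : ℝ) : ℂ) *
    (Real.cos (4 * t * Real.log (Real.sqrt (r + 1) + Real.sqrt r)) : ℝ)

open scoped FourierTransform

lemma aux_int_exp {a : ℝ} (ha : 0 < a) : Integrable (fun t : ℝ => Real.exp (-a * |t|)) := by
  rw [← integrableOn_univ, ← Set.Iic_union_Ioi (a := (0:ℝ))]
  refine IntegrableOn.union ?_ ?_
  · refine (integrableOn_exp_mul_Iic ha 0).congr_fun ?_ measurableSet_Iic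
    intro t ht
    simp only [Set.mem_Iic] at ht
    simp [abs_of_nonpos ht]
  · refine (integrableOn_exp_mul_Ioi (a := -a) (by linarith) 0).congr_fun ?_ measurableSet_Ioi
    intro t ht
    simp only [Set.mem_Ioi] at ht
    simp [abs_of_pos ht]

lemma aux_norm_exp (ζ : ℂ) (t : ℝ) : ‖Complex.exp (Complex.I * ζ * t)‖ ≤ Real.exp (|ζ.im| * |t|) := by
  rw [Complex.norm_exp]
  apply Real.exp_le_exp.2
  have : (Complex.I * ζ * t).re = -(ζ.im * t) := by simp
  rw [this, ← abs_mul]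
  exact neg_le_abs _

lemma aux_uniq (F : ℝ → ℂ) (hc : Continuous F) (he : ∀ t, F (-t) = F t) (C δ : ℝ) (hδ : 0 < δ)
    (hb : ∀ t, ‖F t‖ ≤ C * Real.exp (-δ * |t|)) (X : ℝ)
    (h : ∀ ξ > X, ∫ t in Set.Ioi (0:ℝ), F t * (Real.cos (ξ * t) : ℝ) = 0) : ∀ t, F t = 0 := by
  have hC : 0 ≤ C := by
    have := (norm_nonneg _).trans (hb 0)
    simpa using this
  set U : Set ℂ := {ζ | |ζ.im| < δ / 2} with hU
  have hUo : IsOpen U := isOpen_lt (by fun_prop) continuous_const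
  have hint : ∀ ζ ∈ U, Integrable (fun t : ℝ => F t * Complex.exp (Complex.I * ζ * t)) := by
    intro ζ hζ
    refine Integrable.mono' ((aux_int_exp (a := δ/2) (by linarith)).const_mul C)
      (by fun_prop) (Filter.Eventually.of_forall fun t => ?_)
    rw [norm_mul]
    calc _ ≤ (C * Real.exp (-δ * |t|)) * Real.exp (|ζ.im| * |t|) :=
          mul_le_mul (hb t) (aux_norm_exp ζ t) (norm_nonneg _) (by positivity)
      _ = C * Real.exp (-δ * |t| + |ζ.im| * |t|) := by rw [mul_assoc, Real.exp_add]
      _ ≤ _ := by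
        gcongr
        have : |ζ.im| < δ / 2 := hζ
        nlinarith [abs_nonneg t]
  set H : ℂ → ℂ := fun ζ => ∫ t : ℝ, F t * Complex.exp (Complex.I * ζ * t) with hH
  have hdiff : DifferentiableOn ℂ H U := by
    intro ζ hζ
    apply DifferentiableAt.differentiableWithinAt
    refine (hasDerivAt_integral_of_dominated_loc_of_deriv_le (μ := volume) (s := U)
      (F := fun (ζ : ℂ) (t : ℝ) => F t * Complex.exp (Complex.I * ζ * t))
      (F' := fun (ζ : ℂ) (t : ℝ) => F t * (Complex.exp (Complex.I * ζ * t) * (Complex.I * t)))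
      (bound := fun t => C * (4 / δ) * Real.exp (-(δ/4) * |t|))
      (hUo.mem_nhds hζ) (Filter.Eventually.of_forall fun ζ => by fun_prop) (hint ζ hζ)
      (by fun_prop) (Filter.Eventually.of_forall fun t ζ hζ => ?_)
      ((aux_int_exp (a := δ/4) (by linarith)).const_mul _)
      (Filter.Eventually.of_forall fun t ζ hζ => ?_)).2.differentiableAt
    · rw [norm_mul, norm_mul]
      have h1 : ‖Complex.I * (t:ℂ)‖ = |t| := by simp
      have h2 : |t| ≤ (4 / δ) * Real.exp (δ/4 * |t|) := by
        have := Real.add_one_le_exp (δ/4 * |t|)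
        have h3 : |t| = (4/δ) * (δ/4 * |t|) := by field_simp
        calc |t| = (4/δ) * (δ/4 * |t|) := h3
          _ ≤ _ := by gcongr; linarith
      calc _ ≤ (C * Real.exp (-δ * |t|)) * (Real.exp (|ζ.im| * |t|) * ((4 / δ) * Real.exp (δ/4 * |t|))) := by
            rw [h1]
            have := hb t
            have := aux_norm_exp ζ t
            gcongr
        _ = C * (4/δ) * Real.exp (-δ * |t| + |ζ.im| * |t| + δ/4*|t|) := by
            rw [Real.exp_add, Real.exp_add]; ring
        _ ≤ _ := by
          gcongr
          have : |ζ.im| < δ / 2 := hζ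
          nlinarith [abs_nonneg t]
    · have h1 : HasDerivAt (fun ζ : ℂ => Complex.I * ζ * t) (Complex.I * t) ζ := by
        simpa using ((hasDerivAt_id ζ).const_mul Complex.I).mul_const (t:ℂ)
      exact (h1.cexp).const_mul (F t)
  have han : AnalyticOnNhd ℂ H U := hdiff.analyticOnNhd hUo
  have hreal : ∀ x : ℝ, (x:ℂ) ∈ U := fun x => by simp [hU, hδ]
  have hvan : ∀ ξ : ℝ, X < ξ → H ξ = 0 := by
    intro ξ hξ
    have hi := hint ξ (hreal ξ)
    have h1 : ∫ t in Set.Iic (0:ℝ), F t * Complex.exp (Complex.I * ξ * t)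
       = ∫ t in Set.Ioi (0:ℝ), F t * Complex.exp (-(Complex.I * ξ * t)) := by
      have := integral_comp_neg_Ioi 0 (fun t : ℝ => F t * Complex.exp (Complex.I * ξ * t))
      rw [neg_zero] at this
      rw [← this]
      simp [he]
    have h2 : Integrable (fun t : ℝ => F t * Complex.exp (-(Complex.I * ξ * t))) := by
      have := hi.comp_neg
      simpa [he] using this
    rw [hH]
    simp only
    rw [← intervalIntegral.integral_Iic_add_Ioi (b := (0:ℝ)) hi.integrableOn hi.integrableOn, h1,
      ← integral_add h2.integrableOn hi.integrableOn]
    have h3 : ∀ t : ℝ, F t * Complex.exp (-(Complex.I * ξ * t)) + F t * Complex.exp (Complex.I * ξ * t)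
      = 2 * (F t * (Real.cos (ξ * t) : ℝ)) := by
      intro t
      push_cast
      rw [Complex.cos]
      ring_nf
    simp_rw [h3]
    rw [integral_const_mul, h ξ hξ, mul_zero]
  have hconn : IsPreconnected U := by
    have : U = Complex.imLm ⁻¹' (Set.Ioo (-(δ/2)) (δ/2)) := by
      ext; simp [hU, abs_lt]
    rw [this]
    exact ((convex_Ioo _ _).linear_preimage _).isPreconnected
  have hzero : Set.EqOn H 0 U := by
    refine han.eqOn_zero_of_preconnected_of_frequently_eq_zero hconn (hreal (X+1)) ?_
    have ht : Filter.Tendsto (fun x : ℝ => (x:ℂ)) (nhdsWithin (X+1) {X+1}ᶜ) (nhdsWithin ((X+1:ℝ):ℂ) {((X+1:ℝ):ℂ)}ᶜ) := by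
      refine Complex.continuous_ofReal.continuousWithinAt.tendsto_nhdsWithin ?_
      intro x hx
      simp only [Set.mem_compl_iff, Set.mem_singleton_iff] at hx ⊢
      exact_mod_cast hx
    refine ht.frequently (Filter.Eventually.frequently ?_)
    have : ∀ᶠ x in nhds (X+1), X < x := lt_mem_nhds (by linarith)
    filter_upwards [nhdsWithin_le_nhds this] with x hx using hvan x hx
  have hF : Integrable F := by simpa using hint 0 (by simp [hU, hδ])
  have hft : 𝓕 F = 0 := by
    ext w
    rw [Real.fourier_real_eq_integral_exp_smul]
    have := hzero (hreal (-2 * Real.pi * w))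
    simp only [hH, Pi.zero_apply] at this ⊢
    rw [← this]
    congr 1
    ext t
    rw [smul_eq_mul, mul_comm]
    congr 2
    push_cast; ring
  have := hc.fourierInv_fourier_eq hF (by rw [hft]; exact integrable_zero _ _ _)
  intro t
  rw [← this, hft]
  simp [Real.fourierInv_eq']

lemma aux_gamma (s : ℂ) (hs : s ≠ 0) :
    Complex.Gamma s * Complex.Gamma (-s) = -(Real.pi / (s * Complex.sin (Real.pi * s))) := by
  have h1 := Complex.Gamma_mul_Gamma_one_sub s
  have h2 := Complex.Gamma_add_one (-s) (neg_ne_zero.2 hs)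
  rw [show (1 - s) = -s + 1 by ring, h2] at h1
  have : s * (Complex.Gamma s * Complex.Gamma (-s)) = -(Real.pi / Complex.sin (Real.pi * s)) := by
    rw [← h1]; ring
  rw [← mul_right_inj' hs, this]
  field_simp

lemma aux_weight (t : ℝ) (ht : 0 < t) :
    Complex.Gamma (2 * Complex.I * t) * Complex.Gamma (-(2 * Complex.I * t)) *
    (Complex.Gamma (1 / 2 + 2 * Complex.I * t) * Complex.Gamma (1 / 2 - 2 * Complex.I * t)) ^ 2 /
    (Complex.Gamma (4 * Complex.I * t) * Complex.Gamma (-(4 * Complex.I * t)))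
     = 4 * Real.pi ^ 2 / (Real.cosh (2 * Real.pi * t) : ℝ) := by
  have hpi : (Real.pi : ℂ) ≠ 0 := by exact_mod_cast Real.pi_ne_zero
  set s : ℂ := 2 * Complex.I * t with hs
  have ht' : (t:ℂ) ≠ 0 := by exact_mod_cast ht.ne'
  have hs0 : s ≠ 0 := by simp [hs, ht.ne']
  have h4 : 4 * Complex.I * t = 2 * s := by rw [hs]; ring
  have hps : Real.pi * s = ((2 * Real.pi * t : ℝ) : ℂ) * Complex.I := by rw [hs]; push_cast; ring
  have hcos : Complex.cos (Real.pi * s) = (Real.cosh (2 * Real.pi * t) : ℝ) := by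
    rw [hps, Complex.cos_mul_I, Complex.ofReal_cosh]
  have hsin : Complex.sin (Real.pi * s) ≠ 0 := by
    rw [hps, Complex.sin_mul_I, ← Complex.ofReal_sinh]
    refine mul_ne_zero ?_ Complex.I_ne_zero
    have : 0 < Real.sinh (2 * Real.pi * t) := Real.sinh_pos_iff.2 (by positivity)
    exact_mod_cast this.ne'
  have hcos0 : Complex.cos (Real.pi * s) ≠ 0 := by
    rw [hcos]; exact_mod_cast (Real.cosh_pos _).ne'
  have hhalf : Complex.Gamma (1 / 2 + s) * Complex.Gamma (1 / 2 - s) = Real.pi / Complex.cos (Real.pi * s) := by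
    have := Complex.Gamma_mul_Gamma_one_sub (1/2 + s)
    rw [show (1 - (1/2 + s)) = 1/2 - s by ring] at this
    rw [this]
    congr 1
    rw [show (Real.pi:ℂ) * (1/2 + s) = Real.pi * s + Real.pi / 2 by ring, Complex.sin_add_pi_div_two]
  rw [h4, aux_gamma s hs0, aux_gamma (2*s) (by simp [hs0]), hhalf, ← hcos,
    show (Real.pi:ℂ) * (2 * s) = 2 * (Real.pi * s) by ring, Complex.sin_two_mul]
  generalize Complex.cos (Real.pi * s) = c at *
  generalize Complex.sin (Real.pi * s) = d at *
  field_simp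
  ring

lemma aux_K_meas (S T : ℝ) (t : ℂ) : Measurable (Kker S T t) := by
  unfold Kker
  fun_prop

lemma aux_Y (S T z : ℝ) (hT : 0 < T) (hz : T < z) (hzS : z ≤ S) (hS : S < 1) :
    (1 + √z) * (√z - √T) / (2 * (1 - √T) * √z) ≤ (1 + √S) * (√S - √T) / (2 * (1 - √T) * √S) := by
  have h1 : 0 < √T := Real.sqrt_pos.2 hT
  have h2 : √T < √z := Real.sqrt_lt_sqrt hT.le hz
  have h3 : √z ≤ √S := Real.sqrt_le_sqrt hzS
  have h4 : √S < 1 := by rw [Real.sqrt_lt' one_pos]; simpa using hS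
  have h5 : 0 < √z := h1.trans h2
  have h6 : 0 < √S := by linarith
  have h7 : 0 < 1 - √T := by linarith
  rw [div_le_div_iff₀ (by positivity) (by positivity)]
  generalize √T = a at *
  generalize √z = b at *
  generalize √S = c at *
  have : 0 ≤ (1 - a) * ((c - b) * (b * c + a)) := by
    have : 0 ≤ c - b := by linarith
    positivity
  nlinarith

noncomputable def auxTheta (S T : ℝ) : ℝ :=
  Real.arcsin (√ ((1 + √S) * (√S - √T) / (2 * (1 - √T) * √S)))

lemma aux_theta_lt (S T : ℝ) (hT : 0 < T) (hTS : T < S) (hS : S < 1) :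
    auxTheta S T < Real.pi / 2 := by
  unfold auxTheta
  rw [Real.arcsin_lt_pi_div_two, Real.sqrt_lt' one_pos]
  have h1 : 0 < √T := Real.sqrt_pos.2 hT
  have h2 : √T < √S := Real.sqrt_lt_sqrt hT.le hTS
  have h4 : √S < 1 := by rw [Real.sqrt_lt' one_pos]; simpa using hS
  have h6 : 0 < √S := by linarith
  have h7 : 0 < 1 - √T := by linarith
  rw [div_lt_iff₀ (by positivity)]
  generalize √T = a at *
  generalize √S = c at *
  have : 0 < (1 - c) * (c + a) := mul_pos (by linarith) (by linarith)
  nlinarith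

lemma aux_K_bound (S T z t : ℝ) (hT : 0 < T) (hz : T < z) (hzS : z ≤ S) (hS : S < 1) :
    ‖Kker S T t z‖ ≤ Real.exp (4 * auxTheta S T * |t|) := by
  unfold Kker
  rw [norm_mul]
  set y := Real.arcsin (√ ((1 + √z) * (√z - √T) / (2 * (1 - √T) * √z))) with hy
  have hy0 : 0 ≤ y := Real.arcsin_nonneg.2 (Real.sqrt_nonneg _)
  have hyθ : y ≤ auxTheta S T :=
    Real.arcsin_le_arcsin (Real.sqrt_le_sqrt (aux_Y S T z hT hz hzS hS))
  have h1 : ‖Complex.cos (4 * Complex.I * t * (y:ℝ))‖ ≤ Real.exp (4 * auxTheta S T * |t|) := by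
    rw [show 4 * Complex.I * (t:ℂ) * (y:ℂ) = ((4 * t * y : ℝ) : ℂ) * Complex.I by push_cast; ring,
      Complex.cos_mul_I, ← Complex.ofReal_cosh, Complex.norm_real, Real.norm_of_nonneg (Real.cosh_pos _).le,
      ← Real.cosh_abs]
    refine (show Real.cosh |4 * t * y| ≤ Real.exp |4 * t * y| from ?_).trans ?_
    · rw [← Real.cosh_add_sinh]
      have : 0 ≤ Real.sinh |4 * t * y| := Real.sinh_nonneg_iff.2 (abs_nonneg _)
      linarith
    · apply Real.exp_le_exp.2
      rw [abs_mul, abs_mul, abs_of_nonneg hy0, abs_of_pos (by norm_num : (0:ℝ) < 4)]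
      nlinarith [abs_nonneg t]
  have h2 : ∀ u : ℝ, ‖Complex.cos (2 * (t:ℂ) * (u:ℝ))‖ ≤ 1 := by
    intro u
    rw [show 2 * (t:ℂ) * (u:ℂ) = ((2 * t * u : ℝ) : ℂ) by push_cast; ring, ← Complex.ofReal_cos,
      Complex.norm_real]
    exact Real.abs_cos_le_one _
  calc _ ≤ Real.exp (4 * auxTheta S T * |t|) * 1 :=
        mul_le_mul h1 (h2 _) (norm_nonneg _) (Real.exp_nonneg _)
    _ = _ := mul_one _

noncomputable def auxW (S T z : ℝ) : ℝ := 1 / ((1 - z) * √(z - T) * √(S - z))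

lemma auxW_int (S T : ℝ) (hTS : T < S) (hS : S < 1) :
    IntervalIntegrable (auxW S T) volume T S := by
  have i1 : IntervalIntegrable (fun z : ℝ => (z - T) ^ (-(1/2) : ℝ)) volume T S := by
    have := (intervalIntegral.intervalIntegrable_rpow' (a := 0) (b := S - T) (r := -(1/2))
      (by norm_num)).comp_sub_right T
    simpa using this
  have i2 : IntervalIntegrable (fun z : ℝ => (S - z) ^ (-(1/2) : ℝ)) volume T S := by
    have := (intervalIntegral.intervalIntegrable_rpow' (a := S - T) (b := 0) (r := -(1/2))
      (by norm_num)).comp_sub_left S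
    simpa using this
  refine ((i1.add i2).const_mul (1 / ((1 - S) * √(S - T)))).mono_fun ?_ ?_
  · apply Measurable.aestronglyMeasurable
    unfold auxW
    fun_prop
  · rw [Set.uIoc_of_le hTS.le]
    have hne : ∀ᵐ z ∂(volume.restrict (Set.Ioc T S)), z ≠ S :=
      ae_restrict_of_ae (by simp [ae_iff])
    filter_upwards [hne, ae_restrict_mem measurableSet_Ioc] with z hzS hz
    have ha : 0 < z - T := by linarith [hz.1]
    have hb : 0 < S - z := by linarith [lt_of_le_of_ne hz.2 hzS]
    have h1 : 0 < 1 - z := by linarith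
    have h2 : 0 < 1 - S := by linarith
    have hc : 0 < S - T := by linarith
    simp only [Real.rpow_neg ha.le, Real.rpow_neg hb.le, ← Real.sqrt_eq_rpow, auxW]
    rw [Real.norm_of_nonneg (by positivity), Real.norm_of_nonneg (by positivity)]
    have hs : √(S - T) ≤ √(z - T) + √(S - z) := by
      rw [Real.sqrt_le_left (by positivity)]
      nlinarith [Real.sq_sqrt ha.le, Real.sq_sqrt hb.le, Real.sqrt_nonneg (z - T), Real.sqrt_nonneg (S - z), mul_nonneg (Real.sqrt_nonneg (z - T)) (Real.sqrt_nonneg (S - z))]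
    have pa := Real.sqrt_pos.2 ha
    have pb := Real.sqrt_pos.2 hb
    have pc := Real.sqrt_pos.2 hc
    calc 1 / ((1 - z) * √(z - T) * √(S - z)) ≤ 1 / ((1 - S) * √(z - T) * √(S - z)) := by
          gcongr; linarith
      _ = 1 / ((1 - S) * √(S - T)) * (√(S - T) / (√(z - T) * √(S - z))) := by field_simp
      _ ≤ 1 / ((1 - S) * √(S - T)) * ((√(z - T) + √(S - z)) / (√(z - T) * √(S - z))) := by gcongr
      _ = _ := by field_simp; ring

lemma aux_integrand_bound (S T z t : ℝ) (hT : 0 < T) (hz : T < z) (hzS : z ≤ S) (hS : S < 1) :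
    ‖Kker S T t z / (((1 - z : ℝ) : ℂ) * (Real.sqrt (z - T) : ℝ) * (Real.sqrt (S - z) : ℝ))‖
      ≤ Real.exp (4 * auxTheta S T * |t|) * auxW S T z := by
  have h1 : 0 < 1 - z := by linarith
  rw [norm_div, ← Complex.ofReal_mul, ← Complex.ofReal_mul, Complex.norm_real,
    Real.norm_of_nonneg (by positivity), div_eq_mul_one_div]
  exact mul_le_mul_of_nonneg_right (aux_K_bound S T z t hT hz hzS hS) (by positivity)

lemma aux_A_bound (S T t : ℝ) (hT : 0 < T) (hTS : T < S) (hS : S < 1) :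
    ‖Aint S T t‖ ≤ (∫ z in T..S, auxW S T z) * Real.exp (4 * auxTheta S T * |t|) := by
  unfold Aint
  rw [mul_comm, ← intervalIntegral.integral_const_mul]
  refine intervalIntegral.norm_integral_le_of_norm_le hTS.le
    (Filter.Eventually.of_forall fun z hz => aux_integrand_bound S T z t hT hz.1 hz.2 hS)
    ((auxW_int S T hTS hS).const_mul _)

lemma aux_A_cont (S T : ℝ) (hT : 0 < T) (hTS : T < S) (hS : S < 1) :
    Continuous (fun t : ℝ => Aint S T t) := by
  rw [continuous_iff_continuousAt]
  intro t₀
  unfold Aint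
  refine intervalIntegral.continuousAt_of_dominated_interval
    (bound := fun z => Real.exp (4 * auxTheta S T * (|t₀| + 1)) * auxW S T z) ?_ ?_
    ((auxW_int S T hTS hS).const_mul _) ?_
  · refine Filter.Eventually.of_forall fun t => Measurable.aestronglyMeasurable ?_
    have := aux_K_meas S T t
    fun_prop
  · have : ∀ᶠ t : ℝ in nhds t₀, |t| < |t₀| + 1 :=
      continuous_abs.continuousAt.eventually_lt continuousAt_const (by simp)
    filter_upwards [this] with t ht
    refine Filter.Eventually.of_forall fun z hz => ?_
    rw [Set.uIoc_of_le hTS.le] at hz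
    refine (aux_integrand_bound S T z t hT hz.1 hz.2 hS).trans ?_
    have hθ : 0 ≤ auxTheta S T := Real.arcsin_nonneg.2 (Real.sqrt_nonneg _)
    have : 0 ≤ auxW S T z := by
      have h1 : 0 < 1 - z := by linarith [hz.2]
      unfold auxW; positivity
    gcongr
  · refine Filter.Eventually.of_forall fun z _ => ?_
    unfold Kker
    fun_prop

lemma aux_A_even (S T t : ℝ) : Aint S T ((-t : ℝ) : ℂ) = Aint S T t := by
  unfold Aint Kker
  simp only [Complex.ofReal_neg, mul_neg, neg_mul, Complex.cos_neg]

theorem stmt_10 (T S : ℝ) (hT : 0 < T) (hTS : T < S) (hS : S < 1)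
    (h : ∃ r₀ > (0 : ℝ), ∀ r > r₀,
      (1 / (Real.pi : ℂ)) *
        ∫ t in Set.Ioi (0 : ℝ),
          wfun r t * (Aint S T t -
            (Real.pi : ℂ) / ((Real.sqrt (1 - T) : ℝ) * (Real.sqrt (1 - S) : ℝ))) = 0) :
    ∀ t : ℝ, Aint S T t =
      (Real.pi : ℂ) / ((Real.sqrt (1 - T) : ℝ) * (Real.sqrt (1 - S) : ℝ)) := by
  obtain ⟨r₀, hr₀, h⟩ := h
  set c : ℂ := (Real.pi : ℂ) / ((Real.sqrt (1 - T) : ℝ) * (Real.sqrt (1 - S) : ℝ)) with hc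
  have hpi : (Real.pi : ℂ) ≠ 0 := by exact_mod_cast Real.pi_ne_zero
  have hθ0 : 0 ≤ auxTheta S T := Real.arcsin_nonneg.2 (Real.sqrt_nonneg _)
  have hθ := aux_theta_lt S T hT hTS hS
  have hcosh : ∀ t : ℝ, ((Real.cosh (2 * Real.pi * t) : ℝ) : ℂ) ≠ 0 := fun t => by
    exact_mod_cast (Real.cosh_pos _).ne'
  have key := aux_uniq (fun t : ℝ => (Aint S T t - c) / (Real.cosh (2 * Real.pi * t) : ℝ))
    (Continuous.div ((aux_A_cont S T hT hTS hS).sub continuous_const)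
      (by fun_prop) hcosh)
    (fun t => by
      simp only [aux_A_even]
      rw [show 2 * Real.pi * -t = -(2 * Real.pi * t) by ring, Real.cosh_neg])
    (2 * ((∫ z in T..S, auxW S T z) + ‖c‖)) (2 * Real.pi - 4 * auxTheta S T) (by linarith)
    (fun t => by
      have h1 : ‖Aint S T t - c‖ ≤
          ((∫ z in T..S, auxW S T z) + ‖c‖) * Real.exp (4 * auxTheta S T * |t|) := by
        refine (norm_sub_le _ _).trans ?_
        have h2 := aux_A_bound S T t hT hTS hS
        have h3 : 1 ≤ Real.exp (4 * auxTheta S T * |t|) := Real.one_le_exp (by positivity)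
        nlinarith [norm_nonneg c]
      have h4 : Real.exp (2 * Real.pi * |t|) / 2 ≤ Real.cosh (2 * Real.pi * t) := by
        rw [← Real.cosh_abs, abs_mul, abs_of_pos (by positivity : 0 < 2 * Real.pi), Real.cosh_eq]
        have := Real.exp_nonneg (-(2 * Real.pi * |t|))
        linarith
      rw [norm_div, Complex.norm_real, Real.norm_of_nonneg (Real.cosh_pos _).le]
      calc _ ≤ ((∫ z in T..S, auxW S T z) + ‖c‖) * Real.exp (4 * auxTheta S T * |t|) /
              (Real.exp (2 * Real.pi * |t|) / 2) := by
            have := (norm_nonneg _).trans h1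
            gcongr
        _ = _ := by
            rw [show -(2 * Real.pi - 4 * auxTheta S T) * |t|
              = 4 * auxTheta S T * |t| - 2 * Real.pi * |t| by ring, Real.exp_sub]
            field_simp)
    (4 * Real.arsinh (√r₀))
    (fun ξ hξ => by
      have hs : √r₀ < Real.sinh (ξ / 4) := by
        rw [← Real.sinh_arsinh (√r₀)]
        exact Real.sinh_lt_sinh.2 (by linarith)
      have hs0 : 0 ≤ Real.sinh (ξ / 4) := (Real.sqrt_nonneg _).trans hs.le
      have hr : Real.sinh (ξ / 4) ^ 2 > r₀ := by
        rw [Real.sqrt_lt' (lt_of_le_of_lt (Real.sqrt_nonneg _) hs)] at hs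
        exact hs
      have hlog : Real.log (√(Real.sinh (ξ / 4) ^ 2 + 1) + √(Real.sinh (ξ / 4) ^ 2)) = ξ / 4 := by
        rw [← Real.cosh_sq, Real.sqrt_sq (Real.cosh_pos _).le, Real.sqrt_sq hs0,
          Real.cosh_add_sinh, Real.log_exp]
      have h1 := h _ hr
      rw [mul_eq_zero, or_iff_right (by simp [hpi])] at h1
      set r := Real.sinh (ξ / 4) ^ 2 with hrdef
      have hrp : ((((1 + r) ^ (-(1 / 2 : ℝ)) : ℝ)) : ℂ) ≠ 0 := by
        have : 0 < (1 + r) ^ (-(1 / 2 : ℝ)) := Real.rpow_pos_of_pos (by positivity) _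
        exact_mod_cast this.ne'
      have h2 : ∀ t ∈ Set.Ioi (0:ℝ), wfun r t * (Aint S T t - c) =
          (4 * Real.pi ^ 2 * (((1 + r) ^ (-(1 / 2 : ℝ)) : ℝ) : ℂ)) *
          ((Aint S T t - c) / (Real.cosh (2 * Real.pi * t) : ℝ) * (Real.cos (ξ * t) : ℝ)) := by
        intro t ht
        unfold wfun
        rw [aux_weight t ht, hlog, show 4 * t * (ξ / 4) = ξ * t by ring]
        ring
      rw [setIntegral_congr_fun measurableSet_Ioi h2, integral_const_mul, mul_eq_zero] at h1
      refine h1.resolve_left ?_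
      exact mul_ne_zero (mul_ne_zero (by norm_num) (pow_ne_zero _ hpi)) hrp)
  intro t
  have := key t
  rw [div_eq_zero_iff, or_iff_left (hcosh t), sub_eq_zero] at this
  exact this
end

section
/- Let 0 < T < S < 1, r > 0 and T ≤ z ≤ S. Then (1/π)·∫_0^∞ w_r(t)·K_t(z) dt = I₁(z)·I₂(r,z), where I₁(z) = π·(1−√z)·(√z+√T)^{1/2}·(√z+√S)^{1/2}·(1−√T)^{1/2}·(1−√S)^{1/2} and I₂(r,z) = (√T+√S−2√S·√T + R·√z + z·(√T+√S−2))/(E(r)+F(r)·z+G(r)·z²); the integral is over real t. -/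
open MeasureTheory

/-- `R = 2r(1−√T)(1−√S)`. -/
noncomputable def Rc (S T r : ℝ) : ℝ := 2 * r * (1 - Real.sqrt T) * (1 - Real.sqrt S)

/-- `E(r) = (√T+√S−2√S√T)² + 2R√S√T`. -/
noncomputable def Ec (S T r : ℝ) : ℝ :=
  (Real.sqrt T + Real.sqrt S - 2 * Real.sqrt S * Real.sqrt T) ^ 2 +
    2 * Rc S T r * Real.sqrt S * Real.sqrt T

/-- `F(r) = 2(√T+√S−2)(√T+√S−2√S√T) + 2R(1+√S√T−2√T−2√S) + R²`. -/
noncomputable def Fc (S T r : ℝ) : ℝ :=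
  2 * (Real.sqrt T + Real.sqrt S - 2) *
      (Real.sqrt T + Real.sqrt S - 2 * Real.sqrt S * Real.sqrt T) +
    2 * Rc S T r * (1 + Real.sqrt S * Real.sqrt T - 2 * Real.sqrt T - 2 * Real.sqrt S) +
    Rc S T r ^ 2

/-- `G(r) = (√T+√S−2)² + 2R`. -/
noncomputable def Gc (S T r : ℝ) : ℝ :=
  (Real.sqrt T + Real.sqrt S - 2) ^ 2 + 2 * Rc S T r

/-- `I₂(r,z) = (√T+√S−2√S√T + R√z + z(√T+√S−2))/(E(r)+F(r)z+G(r)z²)`. -/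
noncomputable def I2c (S T r z : ℝ) : ℝ :=
  (Real.sqrt T + Real.sqrt S - 2 * Real.sqrt S * Real.sqrt T + Rc S T r * Real.sqrt z +
      z * (Real.sqrt T + Real.sqrt S - 2)) /
    (Ec S T r + Fc S T r * z + Gc S T r * z ^ 2)

/-- `Q_{S,T}(r) = (1+r)·∫_T^S I₂(r,z)/((1+√z)√(√z−√T)√(√S−√z)) dz`. -/
noncomputable def Qc (S T r : ℝ) : ℝ :=
  (1 + r) * ∫ z in T..S, I2c S T r z /
    ((1 + Real.sqrt z) * Real.sqrt (Real.sqrt z - Real.sqrt T) *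
      Real.sqrt (Real.sqrt S - Real.sqrt z))

/-- `I₁(z) = π(1−√z)(√z+√T)^{1/2}(√z+√S)^{1/2}(1−√T)^{1/2}(1−√S)^{1/2}`. -/
noncomputable def I1c (S T z : ℝ) : ℝ :=
  Real.pi * (1 - Real.sqrt z) * (Real.sqrt z + Real.sqrt T) ^ (1 / 2 : ℝ) *
    (Real.sqrt z + Real.sqrt S) ^ (1 / 2 : ℝ) * (1 - Real.sqrt T) ^ (1 / 2 : ℝ) *
    (1 - Real.sqrt S) ^ (1 / 2 : ℝ)

lemma aux_sig (p : ℂ) (y : ℝ) :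
    |Real.sigmoid y * (1 - Real.sigmoid y)| •
      (((Real.sigmoid y : ℝ) : ℂ) ^ (p - 1) * (1 - ((Real.sigmoid y : ℝ) : ℂ)) ^ ((1 - p) - 1))
      = (Real.sigmoid y : ℂ) * Complex.exp ((p - 1) * y) := by
  have h0 := Real.sigmoid_pos y
  have h1 : 0 < 1 - Real.sigmoid y := sub_pos.2 (Real.sigmoid_lt_one y)
  have hlog : Real.log (Real.sigmoid y) = y + Real.log (1 - Real.sigmoid y) := by
    have h := Real.sigmoid_mul_rexp_neg y
    rw [Real.sigmoid_neg] at h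
    rw [← h, Real.log_mul h0.ne' (Real.exp_pos _).ne', Real.log_exp]
    ring
  have e1 : ((1 - Real.sigmoid y : ℝ) : ℂ) = Complex.exp (Real.log (1 - Real.sigmoid y)) := by
    rw [← Complex.ofReal_exp, Real.exp_log h1]
  have h0c : ((Real.sigmoid y : ℝ) : ℂ) ≠ 0 := by exact_mod_cast h0.ne'
  have h1c : ((1 - Real.sigmoid y : ℝ) : ℂ) ≠ 0 := by exact_mod_cast h1.ne'
  rw [abs_of_pos (mul_pos h0 h1), Complex.real_smul]
  have e2 : (1 : ℂ) - ((Real.sigmoid y : ℝ) : ℂ) = ((1 - Real.sigmoid y : ℝ) : ℂ) := by push_cast; ring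
  rw [e2, Complex.cpow_def_of_ne_zero h0c, Complex.cpow_def_of_ne_zero h1c,
    ← Complex.ofReal_log h0.le, ← Complex.ofReal_log h1.le, hlog, Complex.ofReal_mul]
  nth_rewrite 1 [e1]
  rw [mul_assoc, ← Complex.exp_add, ← Complex.exp_add]
  congr 2
  push_cast
  ring

lemma aux_beta (p : ℂ) (h0 : 0 < p.re) (h1 : p.re < 1) :
    Integrable (fun y : ℝ => (Real.sigmoid y : ℂ) * Complex.exp ((p - 1) * y)) ∧
    ∫ y : ℝ, (Real.sigmoid y : ℂ) * Complex.exp ((p - 1) * y) =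
      Real.pi / Complex.sin (Real.pi * p) := by
  have hq : 0 < (1 - p).re := by simp; linarith
  have hd : ∀ x ∈ (Set.univ : Set ℝ), HasDerivWithinAt Real.sigmoid
      (Real.sigmoid x * (1 - Real.sigmoid x)) Set.univ x :=
    fun x _ => (Real.hasDerivAt_sigmoid x).hasDerivWithinAt
  have hinj : Set.InjOn Real.sigmoid Set.univ := Real.sigmoid_injective.injOn
  have hr : Real.sigmoid '' Set.univ = Set.Ioo 0 1 := by
    rw [Set.image_univ, Real.range_sigmoid]
  have hA := (integrableOn_image_iff_integrableOn_abs_deriv_smul MeasurableSet.univ hd hinj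
    (fun x : ℝ => (x : ℂ) ^ (p - 1) * (1 - (x : ℂ)) ^ ((1 - p) - 1))).1 (by
      rw [hr]
      exact ((intervalIntegrable_iff_integrableOn_Ioc_of_le zero_le_one).1
        (Complex.betaIntegral_convergent h0 hq)).mono_set Set.Ioo_subset_Ioc_self)
  have hB := integral_image_eq_integral_abs_deriv_smul MeasurableSet.univ hd hinj
    (fun x : ℝ => (x : ℂ) ^ (p - 1) * (1 - (x : ℂ)) ^ ((1 - p) - 1))
  simp only [aux_sig] at hA hB
  rw [integrableOn_univ] at hA
  refine ⟨hA, ?_⟩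
  rw [hr, setIntegral_univ, ← integral_Ioc_eq_integral_Ioo,
    ← intervalIntegral.integral_of_le zero_le_one] at hB
  rw [← hB, ← Complex.Gamma_mul_Gamma_one_sub, Complex.Gamma_mul_Gamma_eq_betaIntegral h0 hq]
  simp [Complex.betaIntegral]

lemma aux_sech (v : ℂ) (hv : |v.re| < 2 * Real.pi) :
    Integrable (fun t : ℝ => Complex.exp (v * t) / Complex.cosh (2 * Real.pi * t)) ∧
    ∫ t : ℝ, Complex.exp (v * t) / Complex.cosh (2 * Real.pi * t) =
      1 / (2 * Complex.cos (v / 4)) := by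
  have hpi := Real.pi_pos
  have hpic : (Real.pi : ℂ) ≠ 0 := by exact_mod_cast hpi.ne'
  obtain ⟨hv1, hv2⟩ := abs_lt.1 hv
  set p : ℂ := 1 / 2 + v / (4 * Real.pi) with hp
  have hre : p.re = 1 / 2 + v.re / (4 * Real.pi) := by
    have : v / (4 * Real.pi) = v / ((4 * Real.pi : ℝ) : ℂ) := by push_cast; rfl
    rw [hp, this, Complex.add_re, Complex.div_ofReal_re]
    norm_num
  have h0 : 0 < p.re := by
    rw [hre]
    have : -(1/2) < v.re / (4 * Real.pi) := by
      rw [lt_div_iff₀ (by positivity)]; linarith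
    linarith
  have h1 : p.re < 1 := by
    rw [hre]
    have : v.re / (4 * Real.pi) < 1/2 := by
      rw [div_lt_iff₀ (by positivity)]; linarith
    linarith
  obtain ⟨hI, hE⟩ := aux_beta p h0 h1
  have key : ∀ t : ℝ, Complex.exp (v * t) / Complex.cosh (2 * Real.pi * t) =
      2 * ((Real.sigmoid (4 * Real.pi * t) : ℂ) * Complex.exp ((p - 1) * ((4 * Real.pi * t : ℝ) : ℂ))) := by
    intro t
    have hc : Complex.cosh (2 * Real.pi * t) ≠ 0 := by
      have : Complex.cosh (2 * Real.pi * t) = ((Real.cosh (2 * Real.pi * t) : ℝ) : ℂ) := by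
        push_cast; rfl
      rw [this]; exact_mod_cast (Real.cosh_pos _).ne'
    have hs : (Real.sigmoid (4 * Real.pi * t) : ℂ) *
        (1 + Complex.exp (-(4 * Real.pi * t))) = 1 := by
      rw [Real.sigmoid_def]
      have : (1 + Real.exp (-(4 * Real.pi * t))) ≠ 0 := by positivity
      have h2 := inv_mul_cancel₀ this
      exact_mod_cast h2
    have e1 : Complex.exp ((p - 1) * ((4 * Real.pi * t : ℝ) : ℂ)) =
        Complex.exp (v * t) * Complex.exp (-(2 * Real.pi * t)) := by
      rw [← Complex.exp_add, hp]; congr 1; push_cast; field_simp; ring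
    have e2 : 2 * Complex.cosh (2 * Real.pi * t) * Complex.exp (-(2 * Real.pi * t)) =
        1 + Complex.exp (-(4 * Real.pi * t)) := by
      rw [Complex.cosh, mul_div_cancel₀ _ (two_ne_zero), add_mul, ← Complex.exp_add,
        ← Complex.exp_add]
      congr 1
      · rw [add_neg_cancel, Complex.exp_zero]
      · congr 1; ring
    rw [e1, div_eq_iff hc]
    linear_combination (-Complex.exp (v * t)) * hs +
      (-Complex.exp (v * t)) * (Real.sigmoid (4 * Real.pi * t) : ℂ) * e2
  simp only [key]
  have h4 : (4 * Real.pi) ≠ 0 := by positivity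
  refine ⟨(hI.comp_mul_left' h4).const_mul 2, ?_⟩
  rw [integral_const_mul, Measure.integral_comp_mul_left
    (fun y : ℝ => (Real.sigmoid y : ℂ) * Complex.exp ((p - 1) * y)) (4 * Real.pi), hE,
    abs_of_pos (by positivity), Complex.real_smul]
  have e3 : Complex.sin (Real.pi * p) = Complex.cos (v / 4) := by
    rw [hp, ← Complex.cos_sub_pi_div_two]; congr 1; field_simp; ring
  rw [e3]
  push_cast
  by_cases hz : Complex.cos (v / 4) = 0
  · simp [hz]
  field_simp
  ring

lemma aux_sech_Ioi (v : ℂ) (hv : |v.re| < 2 * Real.pi) :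
    IntegrableOn (fun t : ℝ => Complex.cosh (v * t) / Complex.cosh (2 * Real.pi * t))
      (Set.Ioi 0) ∧
    ∫ t in Set.Ioi (0 : ℝ), Complex.cosh (v * t) / Complex.cosh (2 * Real.pi * t) =
      1 / (4 * Complex.cos (v / 4)) := by
  obtain ⟨hI, hE⟩ := aux_sech v hv
  obtain ⟨hI', -⟩ := aux_sech (-v) (by simpa using hv)
  have e : ∀ t : ℝ, Complex.cosh (v * t) / Complex.cosh (2 * Real.pi * t) =
      1 / 2 * (Complex.exp (v * t) / Complex.cosh (2 * Real.pi * t) +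
        Complex.exp (-v * t) / Complex.cosh (2 * Real.pi * t)) := by
    intro t
    nth_rewrite 1 [Complex.cosh]
    rw [neg_mul]; ring
  simp only [e]
  refine ⟨((hI.add hI').const_mul (1/2)).integrableOn, ?_⟩
  rw [integral_const_mul, integral_add hI.integrableOn hI'.integrableOn]
  have h2 := integral_comp_neg_Ioi (0 : ℝ)
    (fun t : ℝ => Complex.exp (v * t) / Complex.cosh (2 * Real.pi * t))
  have h3 : ∀ t : ℝ, Complex.exp (v * (-t : ℝ)) / Complex.cosh (2 * Real.pi * (-t : ℝ)) =
      Complex.exp (-v * t) / Complex.cosh (2 * Real.pi * t) := by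
    intro t
    push_cast
    rw [mul_neg, mul_neg, Complex.cosh_neg, neg_mul]
  simp only [h3, neg_zero] at h2
  have h4 := intervalIntegral.integral_Iic_add_Ioi (b := (0:ℝ)) hI.integrableOn hI.integrableOn
  rw [h2, add_comm, h4, hE]
  by_cases hz : Complex.cos (v / 4) = 0
  · simp [hz]
  field_simp
  ring

lemma aux_w (r t : ℝ) (ht : 0 < t) :
    wfun r t = 4 * Real.pi ^ 2 / Complex.cosh (2 * Real.pi * t) *
      (((1 + r) ^ (-(1 / 2 : ℝ)) : ℝ) : ℂ) *
      (Real.cos (4 * t * Real.log (Real.sqrt (r + 1) + Real.sqrt r)) : ℝ) := by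
  unfold wfun
  congr 2
  have hpi := Real.pi_pos
  have hpic : (Real.pi : ℂ) ≠ 0 := by exact_mod_cast hpi.ne'
  have htc : (t : ℂ) ≠ 0 := by exact_mod_cast ht.ne'
  have gen : ∀ w : ℂ, w ≠ 0 → Complex.Gamma w * Complex.Gamma (-w) =
      -(Real.pi / (w * Complex.sin (Real.pi * w))) := by
    intro w hw
    have h := Complex.Gamma_mul_Gamma_one_sub w
    have h2 := Complex.Gamma_add_one (-w) (neg_ne_zero.2 hw)
    rw [show (1 : ℂ) - w = -w + 1 by ring, h2] at h
    rw [mul_comm w, ← div_div, ← h]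
    field_simp
  set w : ℂ := 2 * Complex.I * t with hw
  have hw0 : w ≠ 0 := by simp [hw, htc]
  have hcc : Complex.cos (Real.pi * w) = Complex.cosh (2 * Real.pi * t) := by
    rw [← Complex.cos_mul_I]; congr 1; rw [hw]; ring
  have hc : Complex.cosh (2 * Real.pi * t) ≠ 0 := by
    have : Complex.cosh (2 * Real.pi * t) = ((Real.cosh (2 * Real.pi * t) : ℝ) : ℂ) := by
      push_cast; rfl
    rw [this]; exact_mod_cast (Real.cosh_pos _).ne'
  have hs : Complex.sin (Real.pi * w) ≠ 0 := by
    have : Complex.sin (Real.pi * w) = ((Real.sinh (2 * Real.pi * t) : ℝ) : ℂ) * Complex.I := by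
      push_cast
      rw [← Complex.sin_mul_I]; congr 1; rw [hw]; ring
    rw [this]
    refine mul_ne_zero ?_ Complex.I_ne_zero
    have : 0 < Real.sinh (2 * Real.pi * t) := Real.sinh_pos_iff.2 (by positivity)
    exact_mod_cast this.ne'
  have h4 : 4 * Complex.I * t = 2 * w := by rw [hw]; ring
  have hh : Complex.Gamma (1 / 2 + w) * Complex.Gamma (1 / 2 - w) =
      Real.pi / Complex.cos (Real.pi * w) := by
    have h := Complex.Gamma_mul_Gamma_one_sub (1 / 2 + w)
    rw [show (1 : ℂ) - (1 / 2 + w) = 1 / 2 - w by ring] at h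
    rw [h, ← Complex.cos_sub_pi_div_two]
    congr 2; ring
  rw [h4, hh, gen w hw0, gen (2 * w) (by simp [hw0]),
    show (Real.pi : ℂ) * (2 * w) = 2 * (Real.pi * w) by ring, Complex.sin_two_mul, ← hcc]
  rw [← hcc] at hc
  field_simp
  try ring

lemma aux_pair (θ δ : ℝ) (hθ : 0 < Real.cos θ) :
    1 / Complex.cos (θ + δ * Complex.I) + 1 / Complex.cos (θ - δ * Complex.I) =
      ((2 * Real.cos θ * Real.cosh δ / (Real.cosh δ ^ 2 - Real.sin θ ^ 2) : ℝ) : ℂ) := by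
  have e1 : Complex.cos (θ + δ * Complex.I) =
      Real.cos θ * Real.cosh δ - Real.sin θ * Real.sinh δ * Complex.I := by
    rw [Complex.cos_add, Complex.cos_mul_I, Complex.sin_mul_I]; push_cast; ring
  have e2 : Complex.cos (θ - δ * Complex.I) =
      Real.cos θ * Real.cosh δ + Real.sin θ * Real.sinh δ * Complex.I := by
    rw [Complex.cos_sub, Complex.cos_mul_I, Complex.sin_mul_I]; push_cast; ring
  have h1 := Real.sin_sq_add_cos_sq θ
  have h2 := Real.cosh_sq δ
  have hp : 0 < Real.cosh δ ^ 2 - Real.sin θ ^ 2 := by nlinarith [sq_nonneg (Real.sinh δ)]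
  have hprod : Complex.cos (θ + δ * Complex.I) * Complex.cos (θ - δ * Complex.I) =
      ((Real.cosh δ ^ 2 - Real.sin θ ^ 2 : ℝ) : ℂ) := by
    have : Real.cosh δ ^ 2 - Real.sin θ ^ 2 =
      (Real.cos θ * Real.cosh δ) ^ 2 + (Real.sin θ * Real.sinh δ) ^ 2 := by
      linear_combination (-Real.cosh δ ^ 2) * h1 + Real.sin θ ^ 2 * h2
    rw [e1, e2, this]
    push_cast
    linear_combination (-(Complex.sin θ * Complex.sinh δ) ^ 2) * Complex.I_sq
  have hne : Complex.cos (θ + δ * Complex.I) * Complex.cos (θ - δ * Complex.I) ≠ 0 := by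
    rw [hprod]; exact_mod_cast hp.ne'
  have ha := left_ne_zero_of_mul hne
  have hb := right_ne_zero_of_mul hne
  rw [div_add_div _ _ ha hb, hprod, e1, e2, Complex.ofReal_div]
  congr 1
  push_cast
  ring

lemma aux_int (α β θ : ℝ) (h0 : 0 ≤ θ) (h1 : θ < Real.pi / 2) :
    ∫ t in Set.Ioi (0 : ℝ), Complex.cos (4 * t * α) * Complex.cos (4 * Complex.I * t * θ) *
      Complex.cos (2 * t * β) / Complex.cosh (2 * Real.pi * t) =
    ((1 / 8 * Real.cos θ * (Real.cosh (α + β / 2) / (Real.cosh (α + β / 2) ^ 2 - Real.sin θ ^ 2) +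
      Real.cosh (α - β / 2) / (Real.cosh (α - β / 2) ^ 2 - Real.sin θ ^ 2)) : ℝ) : ℂ) := by
  have hcos : 0 < Real.cos θ := Real.cos_pos_of_mem_Ioo ⟨by linarith [Real.pi_pos], h1⟩
  have hv : ∀ δ : ℝ, |((4 * θ + 4 * δ * Complex.I : ℂ)).re| < 2 * Real.pi := by
    intro δ
    have : ((4 * θ + 4 * δ * Complex.I : ℂ)).re = 4 * θ := by simp
    rw [this, abs_of_nonneg (by linarith)]; linarith
  obtain ⟨i1, j1⟩ := aux_sech_Ioi _ (hv (α + β / 2))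
  obtain ⟨i2, j2⟩ := aux_sech_Ioi _ (hv (-(α + β / 2)))
  obtain ⟨i3, j3⟩ := aux_sech_Ioi _ (hv (α - β / 2))
  obtain ⟨i4, j4⟩ := aux_sech_Ioi _ (hv (-(α - β / 2)))
  have key : ∀ t : ℝ, Complex.cos (4 * t * α) * Complex.cos (4 * Complex.I * t * θ) *
      Complex.cos (2 * t * β) / Complex.cosh (2 * Real.pi * t) =
      1 / 4 * (((Complex.cosh ((4 * θ + 4 * (α + β / 2 : ℝ) * Complex.I) * t) /
          Complex.cosh (2 * Real.pi * t) +
        Complex.cosh ((4 * θ + 4 * (-(α + β / 2) : ℝ) * Complex.I) * t) /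
          Complex.cosh (2 * Real.pi * t)) +
        Complex.cosh ((4 * θ + 4 * (α - β / 2 : ℝ) * Complex.I) * t) /
          Complex.cosh (2 * Real.pi * t)) +
        Complex.cosh ((4 * θ + 4 * (-(α - β / 2) : ℝ) * Complex.I) * t) /
          Complex.cosh (2 * Real.pi * t)) := by
    intro t
    rw [← add_div, ← add_div, ← add_div, ← mul_div_assoc]
    congr 1
    have a1 : (4 * θ + 4 * (α + β / 2 : ℝ) * Complex.I) * t =
      4 * t * θ + (4 * t * α + 2 * t * β) * Complex.I := by push_cast; ring
    have a2 : (4 * θ + 4 * (-(α + β / 2) : ℝ) * Complex.I) * t =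
      4 * t * θ - (4 * t * α + 2 * t * β) * Complex.I := by push_cast; ring
    have a3 : (4 * θ + 4 * (α - β / 2 : ℝ) * Complex.I) * t =
      4 * t * θ + (4 * t * α - 2 * t * β) * Complex.I := by push_cast; ring
    have a4 : (4 * θ + 4 * (-(α - β / 2) : ℝ) * Complex.I) * t =
      4 * t * θ - (4 * t * α - 2 * t * β) * Complex.I := by push_cast; ring
    have a5 : 4 * Complex.I * t * θ = (4 * t * θ) * Complex.I := by ring
    rw [a1, a2, a3, a4, a5, Complex.cosh_add, Complex.cosh_sub, Complex.cosh_add,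
      Complex.cosh_sub, Complex.cosh_mul_I, Complex.cosh_mul_I, Complex.cos_mul_I,
      Complex.cos_add, Complex.cos_sub]
    ring
  simp only [key]
  rw [integral_const_mul, integral_add ?_ i4, integral_add ?_ i3,
    integral_add i1 i2, j1, j2, j3, j4]
  rotate_left
  · exact i1.add i2
  · exact (i1.add i2).add i3
  have b : ∀ δ : ℝ, (4 * θ + 4 * δ * Complex.I) / 4 = (θ : ℂ) + δ * Complex.I := by
    intro δ; ring
  have b' : ∀ δ : ℝ, (θ : ℂ) + ((-δ : ℝ) : ℂ) * Complex.I = θ - δ * Complex.I := by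
    intro δ; push_cast; ring
  rw [b, b, b, b, b', b']
  have p1 := aux_pair θ (α + β / 2) hcos
  have p2 := aux_pair θ (α - β / 2) hcos
  calc _ = 1 / 16 * ((1 / Complex.cos (θ + (α + β / 2 : ℝ) * Complex.I) +
        1 / Complex.cos (θ - (α + β / 2 : ℝ) * Complex.I)) +
        (1 / Complex.cos (θ + (α - β / 2 : ℝ) * Complex.I) +
        1 / Complex.cos (θ - (α - β / 2 : ℝ) * Complex.I))) := by
        simp only [one_div, mul_inv]; ring
    _ = _ := by
        rw [p1, p2]
        rw [← Complex.ofReal_add]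
        norm_num only [Complex.ofReal_mul, Complex.ofReal_add, Complex.ofReal_div,
          Complex.ofReal_sub, Complex.ofReal_pow, Complex.ofReal_one, Complex.ofReal_ofNat]
        ring

lemma aux_log (x : ℝ) (hx : 0 ≤ x) :
    Real.cosh (Real.log (Real.sqrt (x + 1) + Real.sqrt x)) = Real.sqrt (x + 1) ∧
    Real.sinh (Real.log (Real.sqrt (x + 1) + Real.sqrt x)) = Real.sqrt x := by
  have h1 : 0 < Real.sqrt (x + 1) := Real.sqrt_pos.2 (by linarith)
  have h2 := Real.sqrt_nonneg x
  have q1 := Real.sq_sqrt (show 0 ≤ x + 1 by linarith)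
  have q2 := Real.sq_sqrt hx
  have h3 : 0 < Real.sqrt (x + 1) + Real.sqrt x := by linarith
  have hi : (Real.sqrt (x + 1) + Real.sqrt x)⁻¹ = Real.sqrt (x + 1) - Real.sqrt x := by
    rw [inv_eq_iff_eq_inv]
    refine eq_inv_of_mul_eq_one_left ?_
    linear_combination q1 - q2
  rw [Real.cosh_eq, Real.sinh_eq, Real.exp_neg, Real.exp_log h3, hi]
  constructor <;> ring

lemma aux_alg (A a B b Y r : ℝ) (hA : A ^ 2 = 1 + r) (ha : a ^ 2 = r) (hb : b ^ 2 = B ^ 2 - 1)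
    (h1 : (A * B + a * b) ^ 2 - Y ≠ 0) (h2 : (A * B - a * b) ^ 2 - Y ≠ 0) :
    (A * B + a * b) / ((A * B + a * b) ^ 2 - Y) + (A * B - a * b) / ((A * B - a * b) ^ 2 - Y) =
      2 * A * B * (B ^ 2 + r - Y) /
        ((B ^ 2 + r) ^ 2 - 2 * Y * ((1 + r) * B ^ 2 + r * (B ^ 2 - 1)) + Y ^ 2) ∧
    (B ^ 2 + r) ^ 2 - 2 * Y * ((1 + r) * B ^ 2 + r * (B ^ 2 - 1)) + Y ^ 2 ≠ 0 := by
  have hp : (A * B + a * b) * (A * B - a * b) = B ^ 2 + r := by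
    linear_combination B ^ 2 * hA - b ^ 2 * ha - r * hb
  have hD : ((A * B + a * b) ^ 2 - Y) * ((A * B - a * b) ^ 2 - Y) =
      (B ^ 2 + r) ^ 2 - 2 * Y * ((1 + r) * B ^ 2 + r * (B ^ 2 - 1)) + Y ^ 2 := by
    rw [← hp]
    linear_combination (-2 * Y * B ^ 2) * hA - 2 * Y * b ^ 2 * ha - 2 * Y * r * hb
  rw [← hD]
  refine ⟨?_, mul_ne_zero h1 h2⟩
  rw [div_add_div _ _ h1 h2]
  congr 1
  rw [← hp]
  ring

lemma aux_rat (s u q r : ℝ) (hq : q ≠ 0) (hs : 1 - s ≠ 0) (hu : 1 - u ≠ 0) (Bs Y R : ℝ)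
    (hB : Bs = (s + q) * (1 - q) / (2 * (1 - s) * q))
    (hY : Y = (1 + q) * (q - u) / (2 * (1 - u) * q))
    (hR : R = 2 * r * (1 - u) * (1 - s)) :
    Bs + r - Y = (u + s - 2 * s * u + R * q + q ^ 2 * (u + s - 2)) /
      (2 * (1 - s) * (1 - u) * q) ∧
    (Bs + r) ^ 2 - 2 * Y * ((1 + r) * Bs + r * (Bs - 1)) + Y ^ 2 =
      (((u + s - 2 * s * u) ^ 2 + 2 * R * s * u) +
       (2 * (u + s - 2) * (u + s - 2 * s * u) + 2 * R * (1 + s * u - 2 * u - 2 * s) + R ^ 2) * q ^ 2 +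
       ((u + s - 2) ^ 2 + 2 * R) * (q ^ 2) ^ 2) / (4 * (1 - u) ^ 2 * (1 - s) ^ 2 * q ^ 2) := by
  subst hB hY hR
  constructor
  · field_simp; ring
  · field_simp; ring

lemma aux_cosh_half (β c : ℝ) (h : Real.cosh β = c) :
    Real.cosh (β / 2) ^ 2 = (c + 1) / 2 := by
  have h1 := Real.cosh_two_mul (β / 2)
  have h2 := Real.cosh_sq (β / 2)
  rw [show 2 * (β / 2) = β by ring, h] at h1
  linarith

lemma aux_sqrt (s u q : ℝ) (hu : 0 < u) (huq : u ≤ q) (hqs : q ≤ s) (hs : s < 1) (c B : ℝ)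
    (hc0 : 0 ≤ c) (hB0 : 0 ≤ B) (hc : c ^ 2 = (1 - q) * (q + u) / (2 * (1 - u) * q))
    (hB : B ^ 2 = (s + q) * (1 - q) / (2 * (1 - s) * q)) :
    c * B = (1 - q) * (q + u) ^ (1 / 2 : ℝ) * (q + s) ^ (1 / 2 : ℝ) * (1 - u) ^ (1 / 2 : ℝ) *
      (1 - s) ^ (1 / 2 : ℝ) / (2 * q * (1 - u) * (1 - s)) := by
  simp only [← Real.sqrt_eq_rpow]
  have hq : 0 < q := by linarith
  have h1 : 0 < 1 - q := by linarith
  have h2 : 0 < 1 - u := by linarith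
  have h3 : 0 < 1 - s := by linarith
  refine (pow_left_inj₀ (mul_nonneg hc0 hB0) (by positivity) two_ne_zero).1 ?_
  rw [mul_pow, hc, hB, div_pow, mul_pow, mul_pow, mul_pow, mul_pow, Real.sq_sqrt (by linarith),
    Real.sq_sqrt (by linarith), Real.sq_sqrt (by linarith), Real.sq_sqrt (by linarith)]
  field_simp
  ring

theorem stmt_13 (T S : ℝ) (hT : 0 < T) (hTS : T < S) (hS : S < 1)
    (r : ℝ) (hr : 0 < r) (z : ℝ) (hz1 : T ≤ z) (hz2 : z ≤ S) :
    (1 / (Real.pi : ℂ)) *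
      ∫ t in Set.Ioi (0 : ℝ), wfun r t * Kker S T (t : ℂ) z =
    ((I1c S T z : ℝ) : ℂ) * ((I2c S T r z : ℝ) : ℂ) := by
  obtain ⟨s, hs⟩ : ∃ s, s = Real.sqrt S := ⟨_, rfl⟩
  obtain ⟨u, hu⟩ : ∃ u, u = Real.sqrt T := ⟨_, rfl⟩
  obtain ⟨q, hq⟩ : ∃ q, q = Real.sqrt z := ⟨_, rfl⟩
  have hz : 0 < z := by linarith
  have hu0 : 0 < u := hu ▸ Real.sqrt_pos.2 hT
  have huq : u ≤ q := by rw [hu, hq]; exact Real.sqrt_le_sqrt hz1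
  have hqs : q ≤ s := by rw [hs, hq]; exact Real.sqrt_le_sqrt hz2
  have hs1 : s < 1 := by rw [hs, Real.sqrt_lt' one_pos]; simpa using hS
  have hq0 : 0 < q := by linarith
  have hSs : S = s ^ 2 := by rw [hs, Real.sq_sqrt (by linarith)]
  have hzq : z = q ^ 2 := by rw [hq, Real.sq_sqrt hz.le]
  have h1q : 0 < 1 - q := by linarith
  have h1u : 0 < 1 - u := by linarith
  have h1s : 0 < 1 - s := by linarith
  obtain ⟨Y, hY⟩ : ∃ Y, Y = (1 + q) * (q - u) / (2 * (1 - u) * q) := ⟨_, rfl⟩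
  obtain ⟨x, hx⟩ : ∃ x, x = (s ^ 2 - q ^ 2) * (1 - q ^ 2) / ((1 - s) ^ 2 * q ^ 2) := ⟨_, rfl⟩
  obtain ⟨θ, hθ⟩ : ∃ θ, θ = Real.arcsin (Real.sqrt Y) := ⟨_, rfl⟩
  obtain ⟨β, hβ⟩ : ∃ β, β = Real.log (Real.sqrt (x + 1) + Real.sqrt x) := ⟨_, rfl⟩
  obtain ⟨α, hα⟩ : ∃ α, α = Real.log (Real.sqrt (r + 1) + Real.sqrt r) := ⟨_, rfl⟩
  have hY0 : 0 ≤ Y := by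
    rw [hY]; exact div_nonneg (mul_nonneg (by linarith) (by linarith)) (by positivity)
  have h1Y : 1 - Y = (1 - q) * (q + u) / (2 * (1 - u) * q) := by
    rw [hY]; field_simp; ring
  have hY1 : Y < 1 := by
    have : 0 < 1 - Y := by rw [h1Y]; positivity
    linarith
  have hsY1 : Real.sqrt Y < 1 := by rw [Real.sqrt_lt' one_pos]; simpa using hY1
  have hsin : Real.sin θ ^ 2 = Y := by
    rw [hθ, Real.sin_arcsin (by linarith [Real.sqrt_nonneg Y]) hsY1.le, Real.sq_sqrt hY0]
  have hθ0 : 0 ≤ θ := hθ ▸ Real.arcsin_nonneg.2 (Real.sqrt_nonneg Y)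
  have hθ1 : θ < Real.pi / 2 := hθ ▸ Real.arcsin_lt_pi_div_two.2 hsY1
  have hcos0 : 0 < Real.cos θ := Real.cos_pos_of_mem_Ioo ⟨by linarith [Real.pi_pos], hθ1⟩
  have hcos2 : Real.cos θ ^ 2 = (1 - q) * (q + u) / (2 * (1 - u) * q) := by
    rw [← h1Y, ← hsin]; linarith [Real.sin_sq_add_cos_sq θ]
  have hx0 : 0 ≤ x := by
    rw [hx]
    refine div_nonneg (mul_nonneg ?_ ?_) (by positivity) <;> nlinarith
  obtain ⟨hcα, hsα⟩ := aux_log r hr.le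
  obtain ⟨hcβ, -⟩ := aux_log x hx0
  rw [← hα] at hcα hsα
  rw [← hβ] at hcβ
  have hx1 : Real.sqrt (x + 1) = (s - q ^ 2) / ((1 - s) * q) := by
    have h : x + 1 = ((s - q ^ 2) / ((1 - s) * q)) ^ 2 := by
      rw [hx]; field_simp; ring
    rw [h, Real.sqrt_sq]
    exact div_nonneg (by nlinarith) (by positivity)
  rw [hx1] at hcβ
  have hB2 : Real.cosh (β / 2) ^ 2 = (s + q) * (1 - q) / (2 * (1 - s) * q) := by
    rw [aux_cosh_half β _ hcβ]; field_simp; ring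
  have hb2 : Real.sinh (β / 2) ^ 2 = Real.cosh (β / 2) ^ 2 - 1 := by
    rw [Real.cosh_sq]; ring
  have hA2 : Real.cosh α ^ 2 = 1 + r := by rw [hcα, Real.sq_sqrt (by linarith)]; ring
  have ha2 : Real.sinh α ^ 2 = r := by rw [hsα, Real.sq_sqrt hr.le]
  have hmain : ∫ t in Set.Ioi (0 : ℝ), wfun r t * Kker S T (t : ℂ) z =
      (4 * Real.pi ^ 2 * (((1 + r) ^ (-(1 / 2 : ℝ)) : ℝ) : ℂ)) *
      ∫ t in Set.Ioi (0 : ℝ), Complex.cos (4 * t * α) * Complex.cos (4 * Complex.I * t * θ) *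
      Complex.cos (2 * t * β) / Complex.cosh (2 * Real.pi * t) := by
    rw [← integral_const_mul]
    refine setIntegral_congr_fun measurableSet_Ioi (fun t ht => ?_)
    change wfun r t * Kker S T (t : ℂ) z = _
    rw [aux_w r t ht, Kker, ← hs, ← hu, ← hq, hSs, hzq, ← hY, ← hx, ← hθ, ← hβ, ← hα]
    push_cast
    ring
  rw [hmain, aux_int α β θ hθ0 hθ1]
  have hne : ∀ δ : ℝ, Real.cosh δ ^ 2 - Y ≠ 0 := by
    intro δ
    have := Real.cosh_sq δ
    have h2 := sq_nonneg (Real.sinh δ)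
    have h3 : 0 < Real.cosh δ ^ 2 - Y := by linarith
    exact h3.ne'
  have n1 := hne (α + β / 2)
  have n2 := hne (α - β / 2)
  rw [hsin]
  rw [Real.cosh_add] at n1 ⊢
  rw [Real.cosh_sub] at n2 ⊢
  obtain ⟨alg, hD⟩ := aux_alg _ _ _ _ Y r hA2 ha2 hb2 n1 n2
  rw [alg]
  obtain ⟨r1, r2⟩ := aux_rat s u q r hq0.ne' h1s.ne' h1u.ne' _ Y (Rc S T r) hB2 hY
    (by rw [Rc, ← hs, ← hu])
  have hcB := aux_sqrt s u q hu0 huq hqs hs1 _ _ hcos0.le (Real.cosh_pos (β / 2)).le hcos2 hB2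
  rw [r2] at hD ⊢
  rw [r1]
  have hAr : (1 + r) ^ (-(1 / 2 : ℝ)) * Real.cosh α = 1 := by
    rw [Real.rpow_neg (by linarith), ← Real.sqrt_eq_rpow, hcα, add_comm 1 r]
    exact inv_mul_cancel₀ (Real.sqrt_pos.2 (by linarith)).ne'
  have hI1 : I1c S T z = Real.pi * (Real.cos θ * Real.cosh (β / 2)) *
      (2 * q * (1 - u) * (1 - s)) := by
    rw [hcB, I1c, ← hs, ← hu, ← hq]
    field_simp
  rw [hI1, I2c, Ec, Fc, Gc, ← hs, ← hu, ← hq, hzq]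
  rw [hzq] at *
  generalize (1 + r) ^ (-(1 / 2 : ℝ)) = m at *
  generalize u + s - 2 * s * u + Rc S T r * q + q ^ 2 * (u + s - 2) = N at *
  generalize (u + s - 2 * s * u) ^ 2 + 2 * Rc S T r * s * u +
       (2 * (u + s - 2) * (u + s - 2 * s * u) + 2 * Rc S T r * (1 + s * u - 2 * u - 2 * s)
        + Rc S T r ^ 2) * q ^ 2 + ((u + s - 2) ^ 2 + 2 * Rc S T r) * (q ^ 2) ^ 2 = D at *
  have hD0 : D ≠ 0 := by
    rintro rfl
    simp at hD
  have hpi := Real.pi_pos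
  have hreal : 1 / Real.pi * (4 * Real.pi ^ 2 * m * (1 / 8 * Real.cos θ *
      (2 * Real.cosh α * Real.cosh (β / 2) * (N / (2 * (1 - s) * (1 - u) * q)) /
        (D / (4 * (1 - u) ^ 2 * (1 - s) ^ 2 * q ^ 2))))) =
      Real.pi * (Real.cos θ * Real.cosh (β / 2)) * (2 * q * (1 - u) * (1 - s)) * (N / D) := by
    have hm : m = 1 / Real.cosh α := by
      rw [eq_div_iff (Real.cosh_pos α).ne']; exact hAr
    have := (Real.cosh_pos α).ne'
    rw [hm]
    field_simp
    try ring
  exact_mod_cast congrArg (fun x : ℝ => (x : ℂ)) hreal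
end
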